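/- Let A ∈ ℂ^{m×m} be nonsingular with polar factor U = P(A) unitary, and let Ũ ∈ ℂ^{m×m} be unitary with ‖A − Ũ‖_F < 1. Then ‖A‖_F^{-1} ‖skew(Ũ*A)‖_F ≤ ‖U − Ũ‖_F ≤ 2 ‖A^{-1}‖_F ‖skew(Ũ*A)‖_F. -/

import Mathlib

open Matrix
open scoped ComplexOrder

/-- Frobenius norm of a complex matrix. -/
noncomputable def frob {m p : ℕ} (A : Matrix (Fin m) (Fin p) ℂ) : ℝ :=
  Real.sqrt (∑ i, ∑ j, ‖A i j‖ ^ 2)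

section Frobenius

attribute [local instance] Matrix.frobeniusNormedAddCommGroup Matrix.frobeniusNormedSpace

lemma frob_eq_norm {m p : ℕ} (A : Matrix (Fin m) (Fin p) ℂ) : frob A = ‖A‖ := by
  rw [frobenius_norm_def, frob, Real.sqrt_eq_rpow]
  simp

lemma frob_mul_le {m p q : ℕ} (A : Matrix (Fin m) (Fin p) ℂ) (B : Matrix (Fin p) (Fin q) ℂ) :
    frob (A * B) ≤ frob A * frob B := by
  simpa only [frob_eq_norm] using frobenius_norm_mul A B

lemma frob_conjTranspose {m p : ℕ} (A : Matrix (Fin m) (Fin p) ℂ) : frob Aᴴ = frob A := by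
  simpa only [frob_eq_norm] using frobenius_norm_conjTranspose A

lemma frob_sub_le {m p : ℕ} (A B : Matrix (Fin m) (Fin p) ℂ) :
    frob (A - B) ≤ frob A + frob B := by
  simpa only [frob_eq_norm] using norm_sub_le A B

lemma frob_smul {m p : ℕ} (c : ℂ) (A : Matrix (Fin m) (Fin p) ℂ) :
    frob (c • A) = ‖c‖ * frob A := by
  simpa only [frob_eq_norm] using norm_smul c A

lemma frob_eq_zero_iff {m p : ℕ} (A : Matrix (Fin m) (Fin p) ℂ) : frob A = 0 ↔ A = 0 := by
  rw [frob_eq_norm, norm_eq_zero]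

end Frobenius

lemma frob_nonneg {m p : ℕ} (A : Matrix (Fin m) (Fin p) ℂ) : 0 ≤ frob A :=
  Real.sqrt_nonneg _

lemma frob_sq {m p : ℕ} (A : Matrix (Fin m) (Fin p) ℂ) :
    frob A ^ 2 = ∑ i, ∑ j, ‖A i j‖ ^ 2 :=
  Real.sq_sqrt (by positivity)

lemma ofReal_frob_sq {m p : ℕ} (A : Matrix (Fin m) (Fin p) ℂ) :
    ((frob A ^ 2 : ℝ) : ℂ) = (Aᴴ * A).trace := by
  rw [frob_sq, Finset.sum_comm]
  simp only [trace, diag_apply, mul_apply, conjTranspose_apply]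
  push_cast
  refine Finset.sum_congr rfl fun i _ => Finset.sum_congr rfl fun j _ => ?_
  rw [← Complex.conj_mul']
  rfl

lemma norm_apply_le_frob {m p : ℕ} (A : Matrix (Fin m) (Fin p) ℂ) (i : Fin m) (j : Fin p) :
    ‖A i j‖ ≤ frob A := by
  refine Real.le_sqrt_of_sq_le ?_
  calc ‖A i j‖ ^ 2 ≤ ∑ l, ‖A i l‖ ^ 2 :=
        Finset.single_le_sum (f := fun l => ‖A i l‖ ^ 2) (fun _ _ => by positivity)
          (Finset.mem_univ j)
    _ ≤ ∑ k, ∑ l, ‖A k l‖ ^ 2 :=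
        Finset.single_le_sum (f := fun k => ∑ l, ‖A k l‖ ^ 2) (fun _ _ => by positivity)
          (Finset.mem_univ i)

lemma sum_norm_diag_sq_le_frob_sq {m : ℕ} (A : Matrix (Fin m) (Fin m) ℂ) :
    ∑ i, ‖A i i‖ ^ 2 ≤ frob A ^ 2 := by
  rw [frob_sq]
  exact Finset.sum_le_sum fun i _ =>
    Finset.single_le_sum (f := fun l => ‖A i l‖ ^ 2) (fun _ _ => by positivity)
      (Finset.mem_univ i)

lemma frob_diagonal_sq {m : ℕ} (d : Fin m → ℂ) :
    frob (diagonal d) ^ 2 = ∑ i, ‖d i‖ ^ 2 := by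
  rw [frob_sq]
  refine Finset.sum_congr rfl fun i _ => ?_
  rw [Finset.sum_eq_single i] <;> simp +contextual [eq_comm]

lemma frob_unitary_mul {m p : ℕ} {Q : Matrix (Fin m) (Fin m) ℂ} (hQ : Qᴴ * Q = 1)
    (A : Matrix (Fin m) (Fin p) ℂ) : frob (Q * A) = frob A := by
  have h : (Q * A)ᴴ * (Q * A) = Aᴴ * A := by
    rw [conjTranspose_mul, Matrix.mul_assoc, ← Matrix.mul_assoc Qᴴ, hQ, Matrix.one_mul]
  rw [← sq_eq_sq₀ (frob_nonneg _) (frob_nonneg _), ← Complex.ofReal_inj, ofReal_frob_sq,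
    ofReal_frob_sq, h]

lemma frob_mul_unitary {m p : ℕ} {Q : Matrix (Fin m) (Fin m) ℂ} (hQ : Q * Qᴴ = 1)
    (A : Matrix (Fin p) (Fin m) ℂ) : frob (A * Q) = frob A := by
  rw [← frob_conjTranspose, conjTranspose_mul, frob_unitary_mul (by simpa using hQ),
    frob_conjTranspose]

/-- If `W * H` is close to the identity, with `H` positive semidefinite, then `-1` is not an
eigenvalue of `W`. -/
lemma isUnit_one_add_of_frob_mul_sub_one_lt {m : ℕ} {W H : Matrix (Fin m) (Fin m) ℂ}
    (hH : H.PosSemidef) (hclose : frob (W * H - 1) < 1) : IsUnit (1 + W) := by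
  rw [isUnit_iff_isUnit_det, isUnit_iff_ne_zero]
  intro hdet
  obtain ⟨v, hv0, hv⟩ := exists_vecMul_eq_zero_iff.mpr hdet
  set X : Matrix (Fin 1) (Fin m) ℂ := replicateRow (Fin 1) v with hX
  have hX0 : frob X ≠ 0 := by
    rw [Ne, frob_eq_zero_iff]
    intro h
    exact hv0 (funext fun j => congrFun (congrFun h 0) j)
  have hXW : X + X * W = 0 := by
    have : X * (1 + W) = 0 := by
      rw [hX, ← replicateRow_vecMul, hv]
      rfl
    simpa [Matrix.mul_add] using this
  have hXE : X * (W * H - 1) * Xᴴ = -(X * H * Xᴴ + X * Xᴴ) := by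
    rw [Matrix.mul_sub, ← Matrix.mul_assoc, eq_neg_of_add_eq_zero_right hXW]
    simp only [Matrix.neg_mul, Matrix.mul_one, Matrix.sub_mul]
    abel
  have hpos : 0 ≤ (X * H * Xᴴ) 0 0 := (hH.mul_mul_conjTranspose_same X).diag_nonneg
  have hXX : (X * Xᴴ) 0 0 = ((frob X ^ 2 : ℝ) : ℂ) := by
    rw [ofReal_frob_sq, trace_mul_comm]
    simp [trace]
  have hle : frob X ^ 2 ≤ frob (X * (W * H - 1) * Xᴴ) := by
    refine le_trans ?_ (norm_apply_le_frob _ 0 0)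
    rw [hXE, Matrix.neg_apply, norm_neg, Matrix.add_apply, hXX]
    refine le_trans ?_ (Complex.re_le_norm _)
    rw [Complex.add_re, Complex.ofReal_re]
    linarith [(Complex.le_def.mp hpos).1, Complex.zero_re]
  have hge : frob (X * (W * H - 1) * Xᴴ) ≤ frob X * frob (W * H - 1) * frob X := by
    refine (frob_mul_le _ _).trans ?_
    rw [frob_conjTranspose]
    exact mul_le_mul_of_nonneg_right (frob_mul_le _ _) (frob_nonneg _)
  have hXpos : 0 < frob X ^ 2 := by positivity
  nlinarith

/-- A unitary matrix without eigenvalue `-1` is unitarily diagonalizable, by the spectral theorem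
for its Cayley transform. -/
lemma exists_unitary_diagonalization {m : ℕ} {W : Matrix (Fin m) (Fin m) ℂ}
    (hW : Wᴴ * W = 1) (hunit : IsUnit (1 + W)) :
    ∃ (Q : Matrix (Fin m) (Fin m) ℂ) (d : Fin m → ℂ),
      Qᴴ * Q = 1 ∧ Q * Qᴴ = 1 ∧ Qᴴ * W * Q = diagonal d := by
  have hdet : IsUnit (1 + W).det := (isUnit_iff_isUnit_det _).mp hunit
  set K : Matrix (Fin m) (Fin m) ℂ := Complex.I • ((1 - W) * (1 + W)⁻¹) with hK
  have hKM : K * (1 + W) = Complex.I • (1 - W) := by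
    rw [hK, Matrix.smul_mul, Matrix.mul_assoc, nonsing_inv_mul _ hdet, Matrix.mul_one]
  have hMK : (1 + W)ᴴ * Kᴴ = -Complex.I • (1 - Wᴴ) := by
    rw [← conjTranspose_mul, hKM]
    simp
  have hherm : K.IsHermitian := by
    have h1 : (1 + W)ᴴ * Kᴴ * (1 + W) = (1 + W)ᴴ * K * (1 + W) := by
      rw [hMK, Matrix.mul_assoc, hKM]
      simp only [conjTranspose_add, conjTranspose_one, Matrix.smul_mul, Matrix.mul_smul,
        Matrix.add_mul, Matrix.mul_add, Matrix.sub_mul, Matrix.mul_sub, hW, Matrix.one_mul,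
        Matrix.mul_one]
      module
    have hunit' : IsUnit (1 + W)ᴴ := hunit.star
    exact hunit'.mul_left_cancel (hunit.mul_right_cancel h1)
  set Q : Matrix (Fin m) (Fin m) ℂ := hherm.eigenvectorUnitary.val
  have hQQ : Qᴴ * Q = 1 := Unitary.coe_star_mul_self hherm.eigenvectorUnitary
  have hQQ' : Q * Qᴴ = 1 := Unitary.coe_mul_star_self hherm.eigenvectorUnitary
  have hspec : Qᴴ * K * Q = diagonal (fun i => (hherm.eigenvalues i : ℂ)) := by
    have h := hherm.conjStarAlgAut_star_eigenvectorUnitary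
    rw [Unitary.conjStarAlgAut_apply] at h
    simpa [star_eq_conjTranspose, Function.comp_def] using h
  have hdiag : (Qᴴ * K * Q) * (Qᴴ * W * Q) + Complex.I • (Qᴴ * W * Q) =
      Complex.I • 1 - Qᴴ * K * Q := by
    have h1 : (Qᴴ * K * Q) * (Qᴴ * W * Q) = Qᴴ * (K * W) * Q := by
      calc (Qᴴ * K * Q) * (Qᴴ * W * Q) = Qᴴ * K * (Q * Qᴴ) * W * Q := by
            simp only [Matrix.mul_assoc]
        _ = Qᴴ * (K * W) * Q := by rw [hQQ']; simp only [Matrix.mul_assoc, Matrix.mul_one]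
    have h2 : K * W = Complex.I • 1 - Complex.I • W - K := by
      rw [← smul_sub, ← hKM, Matrix.mul_add, Matrix.mul_one, add_sub_cancel_left]
    rw [h1, h2]
    simp only [Matrix.mul_sub, Matrix.sub_mul, Matrix.mul_smul, Matrix.smul_mul, Matrix.mul_one,
      hQQ]
    abel
  refine ⟨Q, fun i => (Qᴴ * W * Q) i i, hQQ, hQQ', ?_⟩
  ext i j
  rcases eq_or_ne i j with rfl | hij
  · simp
  · have h := congrFun (congrFun hdiag i) j
    rw [hspec] at h
    simp only [Matrix.add_apply, Matrix.sub_apply, Matrix.smul_apply, diagonal_mul,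
      one_apply_ne hij, diagonal_apply_ne _ hij, smul_eq_mul, mul_zero, sub_zero] at h
    rw [diagonal_apply_ne _ hij]
    rw [← add_mul] at h
    refine (mul_eq_zero.mp h).resolve_left fun h0 => ?_
    simpa using congrArg Complex.im h0

/-- The diagonal entries of a positive definite matrix and of its inverse have product at least
one. -/
lemma Matrix.PosDef.one_le_diag_mul_inv_diag {m : ℕ} {H : Matrix (Fin m) (Fin m) ℂ}
    (hH : H.PosDef) (i : Fin m) : 1 ≤ (H i i).re * (H⁻¹ i i).re := by
  have hpos : 0 < (H i i).re := (Complex.lt_def.mp (hH.diag_pos (i := i))).1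
  have hdet : IsUnit H.det := (isUnit_iff_isUnit_det _).mp hH.isUnit
  set c : ℝ := (H i i).re with hc
  have hps : (H - (2 * c : ℂ) • 1 + (c ^ 2 : ℂ) • H⁻¹).PosSemidef := by
    have h := hH.posSemidef.conjTranspose_mul_mul_same (1 - (c : ℂ) • H⁻¹)
    convert h using 1
    have hinv : (H⁻¹)ᴴ = H⁻¹ := hH.inv.isHermitian
    simp only [conjTranspose_sub, conjTranspose_one, conjTranspose_smul, hinv, Matrix.sub_mul,
      Matrix.mul_sub, Matrix.one_mul, Matrix.mul_one, Matrix.smul_mul, Matrix.mul_smul,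
      nonsing_inv_mul _ hdet, mul_nonsing_inv _ hdet, RCLike.star_def, Complex.conj_ofReal]
    module
  have h := (Complex.le_def.mp (hps.diag_nonneg (i := i))).1
  have h' : 0 ≤ c - 2 * c + c ^ 2 * (H⁻¹ i i).re := by
    have e : (H - (2 * c : ℂ) • 1 + (c ^ 2 : ℂ) • H⁻¹) i i =
        H i i - ((2 * c : ℝ) : ℂ) + ((c ^ 2 : ℝ) : ℂ) * H⁻¹ i i := by
      simp
    rw [e, Complex.add_re, Complex.sub_re, Complex.ofReal_re, Complex.re_ofReal_mul] at h
    simpa using h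
  nlinarith

/-- For a unit complex number in the right half plane, the distance to one is controlled by the
imaginary part. -/
lemma norm_sub_one_sq_le_of_re_nonneg {z : ℂ} (hz : ‖z‖ = 1) (hre : 0 ≤ z.re) :
    ‖z - 1‖ ^ 2 ≤ 4 * z.im ^ 2 := by
  have h1 : z.re ^ 2 + z.im ^ 2 = 1 := by
    have := Complex.sq_norm z
    rw [hz, Complex.normSq_apply] at this
    linarith
  rw [Complex.sq_norm, Complex.normSq_apply]
  simp only [Complex.sub_re, Complex.sub_im, Complex.one_re, Complex.one_im]
  nlinarith [sq_nonneg (z.re - 1)]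

lemma frob_diagonal_sub_one_le {m : ℕ} {d : Fin m → ℂ} {H : Matrix (Fin m) (Fin m) ℂ}
    (hd : ∀ i, ‖d i‖ = 1) (hH : H.PosDef) (hclose : frob (diagonal d * H - 1) < 1) :
    frob (diagonal d - 1) ≤
      2 * frob H⁻¹ * frob ((1 / 2 : ℂ) • (diagonal d * H - (diagonal d * H)ᴴ)) := by
  set S := (1 / 2 : ℂ) • (diagonal d * H - (diagonal d * H)ᴴ) with hS
  have key : ∀ i, ‖d i - 1‖ ^ 2 ≤ 4 * frob H⁻¹ ^ 2 * ‖S i i‖ ^ 2 := by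
    intro i
    have hpos := Complex.lt_def.mp (hH.diag_pos (i := i))
    have him : (H i i).im = 0 := by simpa using hpos.2.symm
    have hre : 0 < (H i i).re := by simpa using hpos.1
    have hHi : H i i = ((H i i).re : ℂ) := Complex.ext rfl (by simpa using him)
    have hdre : 0 ≤ (d i).re := by
      have h1 := (norm_apply_le_frob (diagonal d * H - 1) i i).trans_lt hclose
      rw [Matrix.sub_apply, diagonal_mul, one_apply_eq, hHi] at h1
      have h2 := (abs_le.mp (Complex.abs_re_le_norm (d i * ((H i i).re : ℂ) - 1))).1
      rw [Complex.sub_re, Complex.re_mul_ofReal, Complex.one_re] at h2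
      by_contra! hneg
      nlinarith
    have hSi : ‖S i i‖ ^ 2 = ((d i).im * (H i i).re) ^ 2 := by
      have : S i i = (((d i).im * (H i i).re : ℝ) : ℂ) * Complex.I := by
        rw [hS, Matrix.smul_apply, Matrix.sub_apply, conjTranspose_apply, diagonal_mul, hHi]
        apply Complex.ext <;> simp
        ring
      rw [this, norm_mul, Complex.norm_I, mul_one, Complex.norm_real, Real.norm_eq_abs, sq_abs]
    have hone : 1 ≤ (H i i).re * frob H⁻¹ :=
      (hH.one_le_diag_mul_inv_diag i).trans (mul_le_mul_of_nonneg_left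
        ((Complex.re_le_norm _).trans (norm_apply_le_frob _ i i)) hre.le)
    have hone' : 1 ≤ ((H i i).re * frob H⁻¹) ^ 2 := one_le_pow₀ hone
    calc ‖d i - 1‖ ^ 2 ≤ 4 * (d i).im ^ 2 := norm_sub_one_sq_le_of_re_nonneg (hd i) hdre
      _ ≤ 4 * (d i).im ^ 2 * ((H i i).re * frob H⁻¹) ^ 2 :=
          le_mul_of_one_le_right (by positivity) hone'
      _ = 4 * frob H⁻¹ ^ 2 * ‖S i i‖ ^ 2 := by rw [hSi]; ring
  refine le_of_sq_le_sq ?_ (mul_nonneg (mul_nonneg zero_le_two (frob_nonneg _)) (frob_nonneg _))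
  rw [← diagonal_one, diagonal_sub, frob_diagonal_sq]
  calc ∑ i, ‖d i - 1‖ ^ 2 ≤ ∑ i, 4 * frob H⁻¹ ^ 2 * ‖S i i‖ ^ 2 :=
        Finset.sum_le_sum fun i _ => key i
    _ = 4 * frob H⁻¹ ^ 2 * ∑ i, ‖S i i‖ ^ 2 := by rw [Finset.mul_sum]
    _ ≤ 4 * frob H⁻¹ ^ 2 * frob S ^ 2 :=
        mul_le_mul_of_nonneg_left (sum_norm_diag_sq_le_frob_sq S) (by positivity)
    _ = (2 * frob H⁻¹ * frob S) ^ 2 := by ring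

lemma frob_unitary_sub_one_le {m : ℕ} {W H : Matrix (Fin m) (Fin m) ℂ}
    (hW : Wᴴ * W = 1) (hH : H.PosDef) (hclose : frob (W * H - 1) < 1) :
    frob (W - 1) ≤ 2 * frob H⁻¹ * frob ((1 / 2 : ℂ) • (W * H - (W * H)ᴴ)) := by
  obtain ⟨Q, d, hQ, hQ', hd⟩ := exists_unitary_diagonalization hW
    (isUnit_one_add_of_frob_mul_sub_one_lt hH.posSemidef hclose)
  have hconj : ∀ B : Matrix (Fin m) (Fin m) ℂ, frob (Qᴴ * B * Q) = frob B := fun B => by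
    rw [frob_mul_unitary hQ', frob_unitary_mul (by simpa using hQ')]
  have hmul : ∀ B C : Matrix (Fin m) (Fin m) ℂ,
      (Qᴴ * B * Q) * (Qᴴ * C * Q) = Qᴴ * (B * C) * Q := fun B C => by
    calc (Qᴴ * B * Q) * (Qᴴ * C * Q) = Qᴴ * B * (Q * Qᴴ) * C * Q := by
          simp only [Matrix.mul_assoc]
      _ = Qᴴ * (B * C) * Q := by rw [hQ', Matrix.mul_one, Matrix.mul_assoc Qᴴ]
  have hstar : ∀ B : Matrix (Fin m) (Fin m) ℂ, (Qᴴ * B * Q)ᴴ = Qᴴ * Bᴴ * Q := fun B => by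
    simp [conjTranspose_mul, Matrix.mul_assoc]
  have hone : Qᴴ * 1 * Q = 1 := by rw [Matrix.mul_one, hQ]
  have hdet : IsUnit H.det := (isUnit_iff_isUnit_det _).mp hH.isUnit
  have hinv : (Qᴴ * H * Q)⁻¹ = Qᴴ * H⁻¹ * Q :=
    inv_eq_right_inv (by rw [hmul, mul_nonsing_inv _ hdet, hone])
  have hQunit : IsUnit Q := IsUnit.of_mul_eq_one _ hQ'
  have hH' : (Qᴴ * H * Q).PosDef :=
    hH.conjTranspose_mul_mul_same (mulVec_injective_of_isUnit hQunit)
  have hdn : ∀ i, ‖d i‖ = 1 := by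
    intro i
    have h : (diagonal d)ᴴ * diagonal d = 1 := by
      rw [← hd, hstar, hmul, hW, hone]
    have hi := congrFun (congrFun h i) i
    rw [diagonal_conjTranspose, diagonal_mul_diagonal, diagonal_apply_eq, one_apply_eq,
      Pi.star_apply, RCLike.star_def, Complex.conj_mul'] at hi
    have hi' : ‖d i‖ ^ 2 = 1 := by exact_mod_cast hi
    exact (pow_eq_one_iff_of_nonneg (norm_nonneg _) two_ne_zero).mp hi'
  have hsub : ∀ B C : Matrix (Fin m) (Fin m) ℂ,
      Qᴴ * B * Q - Qᴴ * C * Q = Qᴴ * (B - C) * Q := fun B C => by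
    rw [Matrix.mul_sub, Matrix.sub_mul]
  have hsub_one : ∀ B : Matrix (Fin m) (Fin m) ℂ, Qᴴ * B * Q - 1 = Qᴴ * (B - 1) * Q :=
    fun B => by rw [← hsub, hone]
  have h := frob_diagonal_sub_one_le hdn hH' (by rwa [← hd, hmul, hsub_one, hconj])
  rwa [← hd, hmul, hsub_one, hconj, hinv, hconj, hstar, hsub, frob_smul, hconj, ← frob_smul] at h

lemma frob_skew_unitary_mul_le {m : ℕ} {W H : Matrix (Fin m) (Fin m) ℂ} (hH : H.IsHermitian) :
    frob ((1 / 2 : ℂ) • (W * H - (W * H)ᴴ)) ≤ frob H * frob (W - 1) := by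
  have h : W * H - (W * H)ᴴ = (W - 1) * H - ((W - 1) * H)ᴴ := by
    simp only [Matrix.sub_mul, Matrix.one_mul, conjTranspose_sub, hH.eq]
    abel
  have h1 := frob_sub_le ((W - 1) * H) ((W - 1) * H)ᴴ
  rw [frob_conjTranspose] at h1
  have h2 := frob_mul_le (W - 1) H
  have h3 : ‖(1 / 2 : ℂ)‖ = 1 / 2 := by norm_num
  rw [frob_smul, h, h3]
  linarith

theorem skew_part_two_sided_bound {m : ℕ}
    (A U U' : Matrix (Fin m) (Fin m) ℂ) (H : Matrix (Fin m) (Fin m) ℂ)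
    (hA : IsUnit A.det)
    (hAUH : A = U * H) (hU : Uᴴ * U = 1) (hH : H.PosDef)
    (hU' : U'ᴴ * U' = 1) (hclose : frob (A - U') < 1) :
    (frob A)⁻¹ * frob ((1 / 2 : ℂ) • (U'ᴴ * A - (U'ᴴ * A)ᴴ)) ≤ frob (U - U') ∧
      frob (U - U') ≤ 2 * frob A⁻¹ * frob ((1 / 2 : ℂ) • (U'ᴴ * A - (U'ᴴ * A)ᴴ)) := by
  have hUU : U * Uᴴ = 1 := mul_eq_one_comm.mp hU
  have hUU' : U' * U'ᴴ = 1 := mul_eq_one_comm.mp hU'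
  have hW : (U'ᴴ * U)ᴴ * (U'ᴴ * U) = 1 := by
    rw [conjTranspose_mul, conjTranspose_conjTranspose, Matrix.mul_assoc, ← Matrix.mul_assoc U',
      hUU', Matrix.one_mul, hU]
  have hWH : U'ᴴ * A = U'ᴴ * U * H := by rw [hAUH, Matrix.mul_assoc]
  have hstar : U'ᴴᴴ * U'ᴴ = 1 := by simpa using hUU'
  have hsub : frob (U - U') = frob (U'ᴴ * U - 1) := by
    rw [← frob_unitary_mul hstar (U - U'), Matrix.mul_sub, hU']
  have hclose' : frob (U'ᴴ * U * H - 1) < 1 := by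
    rwa [← hWH, ← hU', ← Matrix.mul_sub, frob_unitary_mul hstar]
  have hAH : frob A = frob H := by rw [hAUH, frob_unitary_mul hU]
  have hAinv : frob A⁻¹ = frob H⁻¹ := by
    rw [hAUH, Matrix.mul_inv_rev, inv_eq_left_inv hU, frob_mul_unitary (by simpa using hU)]
  rw [hWH, hsub, hAH, hAinv]
  refine ⟨?_, frob_unitary_sub_one_le hW hH hclose'⟩
  rcases (frob_nonneg H).eq_or_lt with h0 | hpos
  · rw [← h0, _root_.inv_zero, zero_mul]
    exact frob_nonneg _
  · rw [inv_mul_le_iff₀ hpos]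
    exact frob_skew_unitary_mul_le hH.isHermitian
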